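/- Validity of symmetry breaking: let X̂ ∈ ℝ^{(d+1)×n} be the matrix whose columns are (xᵢ, 1), and for Γ ∈ A write ẑⱼ(Γ) = X̂ Γ e_j ∈ ℝ^{d+1}. For any vector a ∈ ℝ^{d+1} and any Γ ∈ A there exists a permutation σ of {1,…,k} such that the column-permuted matrix Γ' (with Γ'ᵢⱼ = Γᵢ,σ(j)) belongs to A, satisfies G(Γ') = G(Γ), and has ⟨a, ẑ₁(Γ')⟩ ≤ ⟨a, ẑ₂(Γ')⟩ ≤ … ≤ ⟨a, ẑ_k(Γ')⟩; consequently min_{Γ∈A} G(Γ) = min over the subset of A with these ordering constraints. -/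

import Mathlib

open Finset

noncomputable section

/-- The set of binary assignment matrices: entries in `{0,1}`, row sums equal to `1`,
column sums at least `1`. -/
def kmeansA (n k : ℕ) : Set (Matrix (Fin n) (Fin k) ℝ) :=
  {Γ | (∀ i j, Γ i j = 0 ∨ Γ i j = 1) ∧ (∀ i, ∑ j, Γ i j = 1) ∧ (∀ j, 1 ≤ ∑ i, Γ i j)}

/-- The concave assignment objective
`G(Γ) = c₀ − Σⱼ ‖Σᵢ Γᵢⱼ xᵢ‖² / (Σᵢ Γᵢⱼ)` with `c₀ = Σᵢ ‖xᵢ‖²`. -/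
def kmeansG {n k d : ℕ} (x : Fin n → EuclideanSpace ℝ (Fin d))
    (Γ : Matrix (Fin n) (Fin k) ℝ) : ℝ :=
  (∑ i, ‖x i‖ ^ 2) - ∑ j, ‖∑ i, Γ i j • x i‖ ^ 2 / (∑ i, Γ i j)

/-- `ẑⱼ(Γ) = X̂ Γ eⱼ ∈ ℝ^{d+1}`, where `X̂` has columns `(xᵢ, 1)`: the first `d`
coordinates are `Σ_l Γ_{lj} x_l` and the last coordinate is `Σ_l Γ_{lj}`. -/
def zhatCol {n k d : ℕ} (x : Fin n → EuclideanSpace ℝ (Fin d))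
    (Γ : Matrix (Fin n) (Fin k) ℝ) (j : Fin k) : Fin (d + 1) → ℝ :=
  Fin.snoc (fun i => ∑ l, Γ l j * x l i) (∑ l, Γ l j)

/-- Validity of symmetry breaking: for every `a ∈ ℝ^{d+1}` and every `Γ ∈ A` there is a
column permutation `σ` such that the permuted matrix stays in `A`, has the same value of
`G`, and satisfies the ordering `⟨a, ẑ₁⟩ ≤ … ≤ ⟨a, ẑ_k⟩`; consequently the minimum of `G`
over `A` equals the minimum over the subset of `A` with these ordering constraints. -/
theorem kmeans_symmetry_breaking (n k d : ℕ) (hk : 1 ≤ k) (hkn : k ≤ n)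
    (x : Fin n → EuclideanSpace ℝ (Fin d)) (a : Fin (d + 1) → ℝ) :
    (∀ Γ ∈ kmeansA n k, ∃ σ : Equiv.Perm (Fin k),
      (fun i j => Γ i (σ j)) ∈ kmeansA n k ∧
      kmeansG x (fun i j => Γ i (σ j)) = kmeansG x Γ ∧
      (∀ j₁ j₂ : Fin k, j₁ ≤ j₂ →
        ∑ p, a p * zhatCol x (fun i j => Γ i (σ j)) j₁ p ≤
          ∑ p, a p * zhatCol x (fun i j => Γ i (σ j)) j₂ p)) ∧
    sInf (kmeansG x '' kmeansA n k) =
      sInf (kmeansG x '' {Γ ∈ kmeansA n k | ∀ j₁ j₂ : Fin k, j₁ ≤ j₂ →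
        ∑ p, a p * zhatCol x Γ j₁ p ≤ ∑ p, a p * zhatCol x Γ j₂ p}) := by
  have h : ∀ Γ ∈ kmeansA n k, ∃ σ : Equiv.Perm (Fin k),
      (fun i j => Γ i (σ j)) ∈ kmeansA n k ∧
      kmeansG x (fun i j => Γ i (σ j)) = kmeansG x Γ ∧
      (∀ j₁ j₂ : Fin k, j₁ ≤ j₂ →
        ∑ p, a p * zhatCol x (fun i j => Γ i (σ j)) j₁ p ≤
          ∑ p, a p * zhatCol x (fun i j => Γ i (σ j)) j₂ p) := by
    rintro Γ ⟨h1, h2, h3⟩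
    refine ⟨Tuple.sort (fun j => ∑ p, a p * zhatCol x Γ j p), ⟨?_, ?_, ?_⟩, ?_, ?_⟩
    · exact fun i j => h1 i _
    · intro i
      rw [← h2 i]
      exact Equiv.sum_comp (Tuple.sort (fun j => ∑ p, a p * zhatCol x Γ j p)) (fun j => Γ i j)
    · exact fun j => h3 _
    · unfold kmeansG
      congr 1
      exact Equiv.sum_comp (Tuple.sort (fun j => ∑ p, a p * zhatCol x Γ j p))
        (fun j => ‖∑ i, Γ i j • x i‖ ^ 2 / (∑ i, Γ i j))
    · intro j₁ j₂ hj
      exact Tuple.monotone_sort (fun j => ∑ p, a p * zhatCol x Γ j p) hj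
  refine ⟨h, ?_⟩
  congr 1
  apply Set.Subset.antisymm
  · rintro _ ⟨Γ, hΓ, rfl⟩
    obtain ⟨σ, hA, hG, ho⟩ := h Γ hΓ
    exact ⟨_, ⟨hA, ho⟩, hG⟩
  · exact Set.image_mono fun Γ hΓ => hΓ.1
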